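/- There exists an absolute constant K such that the following holds for every sufficiently large prime p. Let A ⊆ 𝔽_p satisfy |A| ≥ √p. Then, with δ = 4/283 and θ = 223/249, there exist disjoint subsets B and C of A with A = B ∪ C and max{E₊(B), E×(C)} ≤ K·|A|³·(|A|/p)^δ·(log |A|)^θ. -/

import Mathlib

open Finset

/-- Additive energy `E₊(B) = #{(b₁,b₂,b₃,b₄) ∈ B⁴ : b₁+b₂ = b₃+b₄}` in `𝔽_p`. -/
def addE {p : ℕ} (B : Finset (ZMod p)) : ℕ :=
  ((B ×ˢ B ×ˢ B ×ˢ B).filter fun x => x.1 + x.2.1 = x.2.2.1 + x.2.2.2).card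

/-- Multiplicative energy `E×(C) = #{(c₁,c₂,c₃,c₄) ∈ C⁴ : c₁c₂ = c₃c₄}` in `𝔽_p`. -/
def mulE {p : ℕ} (C : Finset (ZMod p)) : ℕ :=
  ((C ×ˢ C ×ˢ C ×ˢ C).filter fun x => x.1 * x.2.1 = x.2.2.1 * x.2.2.2).card

theorem card_filter_eq_sum_fibers {α α' β : Type*} [DecidableEq β] (S : Finset α) (S' : Finset α')
    {T : Finset β} (f : α → β) (g : α' → β) (hf : ∀ u ∈ S, f u ∈ T) :
    #{q ∈ S ×ˢ S' | f q.1 = g q.2} = ∑ t ∈ T, #{u ∈ S | f u = t} * #{v ∈ S' | g v = t} := by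
  rw [card_eq_sum_card_fiberwise (f := fun q => f q.1) (t := T)]
  · refine sum_congr rfl fun t _ => ?_
    rw [← card_product, filter_filter]
    congr 1
    ext ⟨u, v⟩
    simp only [mem_filter, mem_product]
    grind
  · intro q hq
    simp only [coe_filter, mem_product, Set.mem_ofPred_eq] at hq
    exact hf _ hq.1.1

theorem sq_card_filter_eq_le {α α' β : Type*} [DecidableEq β]
    (S : Finset α) (S' : Finset α') (f : α → β) (g : α' → β) :
    #{q ∈ S ×ˢ S' | f q.1 = g q.2} ^ 2 ≤
      #{q ∈ S ×ˢ S | f q.1 = f q.2} * #{q ∈ S' ×ˢ S' | g q.1 = g q.2} := by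
  have hS : ∀ u ∈ S, f u ∈ S.image f ∪ S'.image g := fun u hu =>
    mem_union_left _ (mem_image_of_mem f hu)
  have hS' : ∀ u ∈ S', g u ∈ S.image f ∪ S'.image g := fun u hu =>
    mem_union_right _ (mem_image_of_mem g hu)
  rw [card_filter_eq_sum_fibers S S' f g hS, card_filter_eq_sum_fibers S S f f hS,
    card_filter_eq_sum_fibers S' S' g g hS']
  simpa only [sq] using sum_mul_sq_le_sq_mul_sq (S.image f ∪ S'.image g)
    (fun t => #{u ∈ S | f u = t}) (fun t => #{v ∈ S' | g v = t})

section DiffRep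
open scoped Pointwise
variable {G : Type*} [AddCommGroup G] [Fintype G] [DecidableEq G]

/-- The elements `a` of `C` with `a - x ∈ C`. -/
def shiftInter (C : Finset G) (x : G) : Finset G := {a ∈ C | a - x ∈ C}

theorem sum_card_shiftInter_mul (C : Finset G) (g : G → ℝ) :
    ∑ x, (#(shiftInter C x) : ℝ) * g x = ∑ a ∈ C, ∑ b ∈ C, g (a - b) := by
  have h : ∀ x, (#(shiftInter C x) : ℝ) * g x = ∑ a ∈ C, if a - x ∈ C then g x else 0 := by
    intro x
    rw [shiftInter, ← nsmul_eq_mul, ← sum_const, sum_filter]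
  simp_rw [h]
  rw [sum_comm]
  refine sum_congr rfl fun a _ => ?_
  rw [← Equiv.sum_comp (Equiv.subLeft a)]
  simp [Equiv.subLeft_apply]

theorem card_filter_sub_mem_sub_mem (C : Finset G) (a b : G) :
    #{x | a - x ∈ C ∧ b - x ∈ C} = #(shiftInter C (a - b)) := by
  refine card_nbij' (fun x => a - x) (fun c => a - c) ?_ ?_ ?_ ?_
  · simp +contextual [shiftInter, Set.MapsTo]
  · intro c hc
    have : b - (a - c) = c - (a - b) := by abel
    simpa [shiftInter, this] using hc
  · simp [Set.LeftInvOn]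
  · simp [Set.LeftInvOn]

/-- Balog–Szemerédi–Gowers: large additive energy (expressed through `shiftInter`) yields a
large subset with small difference set. -/
theorem exists_subset_card_sub_le (C : Finset G) {N M : ℝ} (hM : 0 < M) (hN : 0 < N)
    (hC : (#C : ℝ) ≤ N) (hE : N ^ 3 / M < ∑ x, (#(shiftInter C x) : ℝ) ^ 2) :
    ∃ D ⊆ C, N / (8 * M) ≤ #D ∧ (#(D - D) : ℝ) * #D ≤ 512 * N ^ 2 * M ^ 2 := by
  set r : G → ℝ := fun x => (#(shiftInter C x) : ℝ) with hr
  have hr0 : ∀ x, 0 ≤ r x := fun x => Nat.cast_nonneg _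
  set m : ℝ := (#C : ℝ) with hm
  have hm0 : 0 ≤ m := Nat.cast_nonneg _
  have hm2 : m ^ 2 ≤ N ^ 2 := by gcongr
  set t : ℝ := N / (16 * M) with ht
  have ht0 : 0 < t := by positivity
  have hsum : ∑ x, r x = m ^ 2 := by
    have := sum_card_shiftInter_mul C (fun _ => 1)
    simpa [sq, m] using this
  set bad : G → G → ℝ := fun x a => ∑ b ∈ shiftInter C x, if r (a - b) < t then 1 else 0 with hbad
  have hbad0 : ∀ x a, 0 ≤ bad x a := fun x a => sum_nonneg fun b _ => by split_ifs <;> simp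
  have hbadsum : ∑ x, ∑ a ∈ shiftInter C x, bad x a ≤ m ^ 2 * t := by
    have h1 : ∀ x, ∑ a ∈ shiftInter C x, bad x a = ∑ a ∈ C, ∑ b ∈ C,
        if r (a - b) < t then (if a - x ∈ C ∧ b - x ∈ C then (1 : ℝ) else 0) else 0 := by
      intro x
      simp only [hbad, shiftInter, sum_filter]
      refine sum_congr rfl fun a _ => ?_
      by_cases ha : a - x ∈ C
      · simp only [ha, if_true, true_and]
        refine sum_congr rfl fun b _ => ?_
        split_ifs <;> simp
      · simp [ha]
    simp_rw [h1]
    rw [sum_comm]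
    calc _ ≤ ∑ a ∈ C, ∑ b ∈ C, t := by
          refine sum_le_sum fun a _ => ?_
          rw [sum_comm]
          refine sum_le_sum fun b _ => ?_
          by_cases h : r (a - b) < t
          · simp only [h, if_true]
            rw [sum_boole, card_filter_sub_mem_sub_mem]
            exact h.le
          · simp [h, ht0.le]
      _ = _ := by simp [m]; ring
  obtain ⟨x, hx1, hx2⟩ : ∃ x, 0 < r x ∧ N / (4 * M) ≤ r x ∧
      8 * ∑ a ∈ shiftInter C x, bad x a ≤ r x ^ 2 := by
    by_contra! hcon
    have h2 : ∀ x, r x ^ 2 ≤ 8 * ∑ a ∈ shiftInter C x, bad x a + r x * (N / (4 * M)) := by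
      intro x
      have hb : 0 ≤ ∑ a ∈ shiftInter C x, bad x a := sum_nonneg fun a _ => hbad0 x a
      have hq : 0 < N / (4 * M) := by positivity
      rcases lt_or_ge (r x) (N / (4 * M)) with h | h
      · nlinarith [hr0 x]
      · have := hcon x (hq.trans_le h) h
        nlinarith [hr0 x]
    have h3 := sum_le_sum fun x (_ : x ∈ (univ : Finset G)) => h2 x
    rw [sum_add_distrib, ← mul_sum, ← sum_mul, hsum] at h3
    have h4 : m ^ 2 * t ≤ N ^ 2 * t := by gcongr
    have h5 : m ^ 2 * (N / (4 * M)) ≤ N ^ 2 * (N / (4 * M)) := by gcongr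
    have h6 : N ^ 2 * t = N ^ 3 / M / 16 := by rw [ht]; field_simp
    have h7 : N ^ 2 * (N / (4 * M)) = N ^ 3 / M / 4 := by field_simp
    have h8 : 0 < N ^ 3 / M := by positivity
    linarith
  obtain ⟨hx2, hx3⟩ := hx2
  set S := shiftInter C x with hS
  have hρ : r x = #S := rfl
  set D := {a ∈ S | bad x a ≤ r x / 4} with hD
  have hDS : D ⊆ S := filter_subset _ _
  have hDρ : r x / 2 ≤ #D := by
    have h1 : ∀ a ∈ S, r x ≤ r x * (if bad x a ≤ r x / 4 then 1 else 0) + 4 * bad x a := by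
      intro a _
      split_ifs with h
      · linarith [hbad0 x a]
      · linarith
    have h2 := sum_le_sum h1
    rw [sum_add_distrib, ← mul_sum, ← mul_sum, sum_boole, sum_const, nsmul_eq_mul, ← hρ] at h2
    have : r x * r x ≤ r x * (#D + r x / 2) := by rw [← hD] at h2; nlinarith
    have := le_of_mul_le_mul_left this hx1
    linarith
  have hDle : (#D : ℝ) ≤ r x := by rw [hρ]; exact_mod_cast card_le_card hDS
  refine ⟨D, hDS.trans (filter_subset _ _), ?_, ?_⟩
  · calc N / (8 * M) = N / (4 * M) / 2 := by field_simp; norm_num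
      _ ≤ r x / 2 := by gcongr
      _ ≤ _ := hDρ
  have hrep : ∀ z ∈ D - D, t ^ 2 * (r x / 2) ≤ ∑ u, r u * r (u - z) := by
    intro z hz
    obtain ⟨a, ha, b, hb, rfl⟩ := mem_sub.1 hz
    rw [← Equiv.sum_comp (Equiv.subLeft a)]
    have ha' := (mem_filter.1 ha).2
    have hb' := (mem_filter.1 hb).2
    calc t ^ 2 * (r x / 2) ≤ t ^ 2 * (r x - bad x a - bad x b) := by gcongr; linarith
      _ = ∑ c ∈ S, t ^ 2 * (1 - (if r (a - c) < t then 1 else 0)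
            - (if r (b - c) < t then 1 else 0)) := by
          rw [← mul_sum, sum_sub_distrib, sum_sub_distrib, hρ]; simp [hbad, ← hS]
      _ ≤ ∑ c ∈ S, r (a - c) * r (b - c) := by
          refine sum_le_sum fun c _ => ?_
          have := mul_nonneg (hr0 (a - c)) (hr0 (b - c))
          split_ifs with h1 h2 h2
          · nlinarith
          · nlinarith
          · nlinarith
          · nlinarith
      _ ≤ ∑ c, r (a - c) * r (b - c) :=
          sum_le_univ_sum_of_nonneg fun c => mul_nonneg (hr0 _) (hr0 _)
      _ = _ := by
          refine sum_congr rfl fun c _ => ?_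
          simp only [Equiv.subLeft_apply]
          congr 2
          abel
  have htot : ∑ z, ∑ u, r u * r (u - z) = m ^ 4 := by
    rw [sum_comm]
    have : ∀ u, ∑ z, r u * r (u - z) = r u * m ^ 2 := by
      intro u
      rw [← mul_sum, ← hsum, ← Equiv.sum_comp (Equiv.subLeft u) r]
      rfl
    simp_rw [this]
    rw [← sum_mul, hsum]
    ring
  have hfin : (#(D - D) : ℝ) * (t ^ 2 * (r x / 2)) ≤ N ^ 4 := by
    calc (#(D - D) : ℝ) * (t ^ 2 * (r x / 2)) = ∑ z ∈ D - D, t ^ 2 * (r x / 2) := by simp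
      _ ≤ ∑ z ∈ D - D, ∑ u, r u * r (u - z) := sum_le_sum hrep
      _ ≤ ∑ z, ∑ u, r u * r (u - z) := sum_le_univ_sum_of_nonneg fun z =>
          sum_nonneg fun u _ => mul_nonneg (hr0 _) (hr0 _)
      _ = m ^ 4 := htot
      _ ≤ N ^ 4 := by gcongr
  have h9 : (#(D - D) : ℝ) * #D * t ^ 2 ≤ 2 * N ^ 4 := by
    have : (#(D - D) : ℝ) * #D * t ^ 2 ≤ (#(D - D) : ℝ) * r x * t ^ 2 := by gcongr
    linarith
  have h10 : 2 * N ^ 4 = 512 * N ^ 2 * M ^ 2 * t ^ 2 := by rw [ht]; field_simp; norm_num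
  rw [h10] at h9
  exact le_of_mul_le_mul_right h9 (by positivity)

end DiffRep
section Pivot
open scoped Pointwise

theorem card_nsmul_sub_nsmul_mul_le {G : Type*} [AddCommGroup G] [DecidableEq G]
    {D : Finset G} (hD : D.Nonempty) {m n k : ℕ} (hk : m + n = k + 1) :
    #(m • D - n • D) * #D ^ k ≤ #(D - D) ^ (k + 1) := by
  have h := pluennecke_ruzsa_inequality_nsmul_sub_nsmul_sub hD D m n
  have hd : (0 : ℚ≥0) < #D := by exact_mod_cast hD.card_pos
  have h2 : (#(m • D - n • D) : ℚ≥0) * #D ^ k ≤ #(D - D) ^ (k + 1) := by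
    calc _ ≤ ((#(D - D) : ℚ≥0) / #D) ^ (k + 1) * #D * #D ^ k := by rw [hk] at h; gcongr
      _ = _ := by rw [div_pow]; field_simp; ring
  exact_mod_cast h2

theorem card_sub_mul_card_le_of_subset {G : Type*} [AddCommGroup G] [DecidableEq G]
    (X : Finset G) {Y Z W H : Finset G} (hY : W ⊆ Y) (hH : W ⊆ H) :
    #(X - Z) * #W ≤ #(X - H) * #(Z - Y) :=
  (ruzsa_triangle_inequality_sub_sub_sub X W Z).trans <|
    Nat.mul_le_mul (card_le_card (sub_subset_sub_left hH)) (card_le_card (sub_subset_sub_left hY))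

theorem card_add_mul_card_le_of_subset {G : Type*} [AddCommGroup G] [DecidableEq G]
    (X : Finset G) {Y Z W H : Finset G} (hY : W ⊆ Y) (hH : W ⊆ H) :
    #(X + Z) * #W ≤ #(X + H) * #(Y - Z) := by
  have h := ruzsa_triangle_inequality_add_sub_add Z W X
  rw [add_comm X Z, add_comm X H, mul_comm, mul_comm #(H + X)]
  exact h.trans <|
    Nat.mul_le_mul (card_le_card (sub_subset_sub_right hY)) (card_le_card (add_subset_add_right hH))

variable {F : Type*} [Field F] [DecidableEq F]

theorem card_dilate_le (c : F) (D : Finset F) :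
    #(c • D - c • D) ≤ #(D - D) ∧ #(c • D + c • D - c • D) ≤ #(2 • D - 1 • D) ∧
      #(c • D - (c • D + c • D)) ≤ #(1 • D - 2 • D) ∧
      #(c • D + c • D - (c • D + c • D)) ≤ #(2 • D - 2 • D) := by
  have hsub : ∀ X Y : Finset F, c • X - c • Y = c • (X - Y) := by
    exact fun X Y => (image_image₂_distrib fun a b => smul_sub c a b).symm
  have hadd : ∀ X Y : Finset F, c • X + c • Y = c • (X + Y) := fun X Y => (smul_add c X Y).symm
  simp only [two_nsmul, one_nsmul, hadd, hsub]
  exact ⟨card_image_le, card_image_le, card_image_le, card_image_le⟩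

theorem card_dilates_sum_mul_le {D : Finset F} (hD : D.Nonempty) (a b c d e : F) :
    #(a • D - b • D + (c • D + c • D) - (d • D + d • D)) *
      (#(a • D ∩ e • D) * #(b • D ∩ e • D) * #(c • D ∩ e • D) * #(d • D ∩ e • D)) * #D ^ 7 ≤
      #(D - D) ^ 12 := by
  set H := e • D
  have h1 := card_sub_mul_card_le_of_subset (a • D - b • D + (c • D + c • D))
    (Z := d • D + d • D) (inter_subset_left (s₁ := d • D) (s₂ := H)) inter_subset_right
  have e1 : a • D - b • D + (c • D + c • D) - H = a • D - b • D - H + (c • D + c • D) := by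
    simp only [sub_eq_add_neg]; ac_rfl
  have h2 := card_add_mul_card_le_of_subset (a • D - b • D - H)
    (Z := c • D + c • D) (inter_subset_left (s₁ := c • D) (s₂ := H)) inter_subset_right
  have e2 : a • D - b • D - H + H = a • D - H + H - b • D := by
    simp only [sub_eq_add_neg]; ac_rfl
  have h3 := card_sub_mul_card_le_of_subset (a • D - H + H)
    (Z := b • D) (inter_subset_left (s₁ := b • D) (s₂ := H)) inter_subset_right
  have e3 : a • D - H + H - H = H - H - H + a • D := by
    simp only [sub_eq_add_neg]; ac_rfl
  have h4 := card_add_mul_card_le_of_subset (H - H - H)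
    (Z := a • D) (inter_subset_left (s₁ := a • D) (s₂ := H)) inter_subset_right
  have e4 : H - H - H + H = H + H - (H + H) := by
    simp only [sub_eq_add_neg, neg_add]; ac_rfl
  rw [e1] at h1
  rw [e2] at h2
  rw [e3] at h3
  rw [e4] at h4
  have k1 := (card_dilate_le d D).2.1
  have k2 := (card_dilate_le c D).2.2.1
  have k3 := (card_dilate_le b D).1
  have k4 := (card_dilate_le a D).1
  have k5 := (card_dilate_le e D).2.2.2
  have q1 := card_nsmul_sub_nsmul_mul_le hD (m := 2) (n := 1) (k := 2) rfl
  have q2 := card_nsmul_sub_nsmul_mul_le hD (m := 1) (n := 2) (k := 2) rfl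
  have q3 := card_nsmul_sub_nsmul_mul_le hD (m := 2) (n := 2) (k := 3) rfl
  have r1 := h1.trans (Nat.mul_le_mul_left _ k1)
  have r2 := h2.trans (Nat.mul_le_mul_left _ k2)
  have r3 := h3.trans (Nat.mul_le_mul_left _ k3)
  have r4 := h4.trans (Nat.mul_le_mul k5 k4)
  clear h1 h2 h3 h4 k1 k2 k3 k4 k5 e1 e2 e3 e4
  generalize #(a • D - b • D + (c • D + c • D) - (d • D + d • D)) = x₀ at *
  generalize #(a • D - b • D - H + (c • D + c • D)) = x₁ at *
  generalize #(a • D - H + H - b • D) = x₂ at *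
  generalize #(H - H - H + a • D) = x₃ at *
  generalize #(a • D ∩ H) = wa at *
  generalize #(b • D ∩ H) = wb at *
  generalize #(c • D ∩ H) = wc at *
  generalize #(d • D ∩ H) = wd at *
  generalize #(D - D) = s at *
  generalize #(2 • D - 1 • D) = y₁ at *
  generalize #(1 • D - 2 • D) = y₂ at *
  generalize #(2 • D - 2 • D) = y₃ at *
  calc x₀ * (wa * wb * wc * wd) * #D ^ 7 = (x₀ * wd) * (wa * wb * wc) * #D ^ 7 := by ring
    _ ≤ (x₁ * y₁) * (wa * wb * wc) * #D ^ 7 := by gcongr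
    _ = (x₁ * wc) * (wa * wb) * y₁ * #D ^ 7 := by ring
    _ ≤ (x₂ * y₂) * (wa * wb) * y₁ * #D ^ 7 := by gcongr
    _ = (x₂ * wb) * wa * y₁ * y₂ * #D ^ 7 := by ring
    _ ≤ (x₃ * s) * wa * y₁ * y₂ * #D ^ 7 := by gcongr
    _ = (x₃ * wa) * s * y₁ * y₂ * #D ^ 7 := by ring
    _ ≤ (y₃ * s) * s * y₁ * y₂ * #D ^ 7 := by gcongr
    _ = (y₁ * #D ^ 2) * (y₂ * #D ^ 2) * (y₃ * #D ^ 3) * s ^ 2 := by ring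
    _ ≤ s ^ (2 + 1) * s ^ (2 + 1) * s ^ (3 + 1) * s ^ 2 := by gcongr
    _ = s ^ 12 := by ring

theorem sq_card_le_card_mul_card_collisions {α β : Type*} [DecidableEq β] (S : Finset α)
    {T : Finset β} {f : α → β} (hf : ∀ u ∈ S, f u ∈ T) :
    #S ^ 2 ≤ #T * #{q ∈ S ×ˢ S | f q.1 = f q.2} := by
  rw [card_filter_eq_sum_fibers S S f f hf,
    card_eq_sum_card_fiberwise (s := S) (f := f) (t := T) hf]
  simp_rw [← sq]
  exact sq_sum_le_card_mul_sum_sq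

theorem exists_ratio_card_sum {p : ℕ} [Fact p.Prime] (A : Finset (ZMod p)) (hA : 1 < #A) :
    ∃ a ∈ A, ∃ b ∈ A, ∃ c ∈ A, ∃ d ∈ A, c ≠ d ∧
      p * #A ^ 2 ≤ #(a • A - b • A + (c • A + c • A) - (d • A + d • A)) * (p + #A ^ 2) := by
  obtain ⟨u, hu, v, hv, huv⟩ := one_lt_card.1 hA
  have key : ∃ a ∈ A, ∃ b ∈ A, ∃ c ∈ A, ∃ d ∈ A, ∃ ξ, c ≠ d ∧ ξ * (c - d) = a - b ∧
      p * #A ^ 2 ≤ #(A + A + ξ • A) * (p + #A ^ 2) := by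
    let R : ZMod p → Prop := fun ξ =>
      ∃ a ∈ A, ∃ b ∈ A, ∃ c ∈ A, ∃ d ∈ A, c ≠ d ∧ ξ * (c - d) = a - b
    by_cases hR : ∀ ξ, R ξ → R (ξ + 1)
    · have hall : ∀ n : ℕ, R n := by
        intro n
        induction n with
        | zero => exact ⟨u, hu, u, hu, u, hu, v, hv, huv, by simp⟩
        | succ n ih => push_cast; exact hR _ ih
      have hall' : ∀ ξ, R ξ := fun ξ => by simpa using hall ξ.val
      obtain ⟨ξ, -, hξ⟩ := exists_le_of_sum_le (s := (univ : Finset (ZMod p)))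
        (f := fun ξ => p * #{q ∈ (A ×ˢ A) ×ˢ (A ×ˢ A) | q.1.1 + ξ * q.1.2 = q.2.1 + ξ * q.2.2})
        (g := fun _ => #A ^ 2 * p + #A ^ 4) univ_nonempty (by
          rw [sum_const, smul_eq_mul, card_univ, ZMod.card, ← mul_sum]
          gcongr
          simp_rw [card_filter]
          rw [sum_comm]
          calc _ ≤ ∑ q ∈ (A ×ˢ A) ×ˢ (A ×ˢ A), ((if q.1 = q.2 then p else 0) + 1) := by
                refine sum_le_sum fun q _ => ?_
                rw [← card_filter]
                split_ifs with h
                · refine (card_le_univ _).trans ?_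
                  rw [ZMod.card]; omega
                · rw [zero_add, card_le_one]
                  intro ξ hξ η hη
                  simp only [mem_filter, mem_univ, true_and] at hξ hη
                  have h1 : (ξ - η) * (q.1.2 - q.2.2) = 0 := by linear_combination hξ - hη
                  rcases mul_eq_zero.1 h1 with h1 | h1
                  · exact sub_eq_zero.1 h1
                  · have h2 := sub_eq_zero.1 h1
                    rw [h2] at hξ
                    exact absurd (Prod.ext (add_right_cancel hξ) h2) h
            _ = #A ^ 2 * p + #A ^ 4 := by
                rw [sum_add_distrib, sum_product]
                simp only [sum_ite_eq, sum_const, card_product, smul_eq_mul]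
                rw [sum_congr rfl fun q hq => if_pos hq, sum_const, card_product, smul_eq_mul]
                ring)
      obtain ⟨a, ha, b, hb, c, hc, d, hd, hcd, h⟩ := hall' ξ
      refine ⟨a, ha, b, hb, c, hc, d, hd, ξ, hcd, h, ?_⟩
      have hcs := sq_card_le_card_mul_card_collisions (A ×ˢ A) (T := A + ξ • A)
        (f := fun q => q.1 + ξ * q.2) (fun q hq => add_mem_add (mem_product.1 hq).1
          (smul_mem_smul_finset (mem_product.1 hq).2))
      have hle : #(A + ξ • A) ≤ #(A + A + ξ • A) := by
        rw [add_assoc]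
        exact card_le_card_add_left ⟨u, hu⟩
      rw [card_product] at hcs
      have hA2 : 0 < #A ^ 2 := by positivity
      refine Nat.le_of_mul_le_mul_left ?_ hA2
      calc #A ^ 2 * (p * #A ^ 2) = p * (#A * #A) ^ 2 := by ring
        _ ≤ p * (#(A + ξ • A) * _) := Nat.mul_le_mul_left _ hcs
        _ = #(A + ξ • A) * (p * _) := by ring
        _ ≤ #(A + A + ξ • A) * (#A ^ 2 * p + #A ^ 4) := Nat.mul_le_mul hle hξ
        _ = _ := by ring
    · push Not at hR
      obtain ⟨ξ, ⟨a, ha, b, hb, c, hc, d, hd, hcd, h⟩, hξ⟩ := hR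
      refine ⟨a, ha, b, hb, c, hc, d, hd, ξ, hcd, h, ?_⟩
      have hinj : #(A ×ˢ A) ≤ #(A + A + ξ • A) := by
        refine card_le_card_of_injOn (fun q => q.1 + q.2 + ξ * q.2) ?_ ?_
        · rintro ⟨x, y⟩ hxy
          obtain ⟨hx, hy⟩ := mem_product.1 hxy
          exact add_mem_add (add_mem_add hx hy) (smul_mem_smul_finset hy)
        · rintro ⟨x, y⟩ hxy ⟨x', y'⟩ hxy' h
          obtain ⟨hx, hy⟩ := mem_product.1 hxy
          obtain ⟨hx', hy'⟩ := mem_product.1 hxy'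
          simp only at h hx hy hx' hy'
          have hyy : y = y' := by
            by_contra hne
            exact hξ ⟨x', hx', x, hx, y, hy, y', hy', hne, by linear_combination h⟩
          subst hyy
          simpa using h
      rw [card_product] at hinj
      calc p * #A ^ 2 = (#A * #A) * p := by ring
        _ ≤ #(A + A + ξ • A) * (p + #A ^ 2) := by gcongr; omega
  obtain ⟨a, ha, b, hb, c, hc, d, hd, ξ, hcd, hξ, h⟩ := key
  refine ⟨a, ha, b, hb, c, hc, d, hd, hcd, h.trans ?_⟩
  refine Nat.mul_le_mul_right _ ?_
  refine card_le_card_of_injOn (fun x => (c - d) * x) ?_ ?_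
  · intro x hmem
    obtain ⟨s, hs, w, hw, rfl⟩ := mem_add.1 hmem
    obtain ⟨x, hx, y, hy, rfl⟩ := mem_add.1 hs
    obtain ⟨z, hz, rfl⟩ := mem_smul_finset.1 hw
    have : (c - d) * (x + y + ξ • z) = (a * z - b * z) + (c * x + c * y) - (d * x + d * y) := by
      rw [smul_eq_mul]; linear_combination z * hξ
    rw [mem_coe]
    simp only [this]
    have hm : ∀ (s x : ZMod p), x ∈ A → s * x ∈ s • A := fun s x hx => smul_mem_smul_finset hx
    exact sub_mem_sub (add_mem_add (sub_mem_sub (hm _ _ hz) (hm _ _ hz))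
      (add_mem_add (hm _ _ hx) (hm _ _ hy))) (add_mem_add (hm _ _ hx) (hm _ _ hy))
  · exact (mul_right_injective₀ (sub_ne_zero.2 hcd)).injOn
end Pivot

section Mul
open scoped Pointwise

/-- The number of solutions of `a₁ a₂ = a₃ a₄` with `aᵢ ∈ Aᵢ`. -/
def mulQuad {p : ℕ} (A₁ A₂ A₃ A₄ : Finset (ZMod p)) : ℕ :=
  #{x ∈ A₁ ×ˢ A₂ ×ˢ A₃ ×ˢ A₄ | x.1 * x.2.1 = x.2.2.1 * x.2.2.2}

variable {p : ℕ} [Fact p.Prime]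

theorem sq_mulQuad_le (A₁ A₂ A₃ A₄ : Finset (ZMod p)) :
    mulQuad A₁ A₂ A₃ A₄ ^ 2 ≤ mulQuad A₁ A₂ A₁ A₂ * mulQuad A₃ A₄ A₃ A₄ := by
  have key : ∀ B₁ B₂ B₃ B₄ : Finset (ZMod p), mulQuad B₁ B₂ B₃ B₄ =
      #{q ∈ (B₁ ×ˢ B₂) ×ˢ (B₃ ×ˢ B₄) | q.1.1 * q.1.2 = q.2.1 * q.2.2} := by
    intro B₁ B₂ B₃ B₄
    refine card_nbij' (fun x => ((x.1, x.2.1), x.2.2)) (fun q => (q.1.1, q.1.2, q.2)) ?_ ?_ ?_ ?_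
    all_goals
      rintro x
      simp +contextual [and_assoc]
  simp only [key]
  exact sq_card_filter_eq_le (A₁ ×ˢ A₂) (A₃ ×ˢ A₄) (fun a => a.1 * a.2) (fun a => a.1 * a.2)

theorem sq_mulQuad_self_le {A B : Finset (ZMod p)} (hA : 0 ∉ A) (hB : 0 ∉ B) :
    mulQuad A B A B ^ 2 ≤ mulE A * mulE B := by
  have hA0 : ∀ a ∈ A, a ≠ 0 := fun a ha h => hA (h ▸ ha)
  have hB0 : ∀ a ∈ B, a ≠ 0 := fun a ha h => hB (h ▸ ha)
  have h := sq_card_filter_eq_le (A ×ˢ A) (B ×ˢ B) (fun a => a.1 / a.2) (fun b => b.2 / b.1)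
  have h1 : mulQuad A B A B ≤
      #{q ∈ (A ×ˢ A) ×ˢ (B ×ˢ B) | q.1.1 / q.1.2 = q.2.2 / q.2.1} := by
    refine card_le_card_of_injOn (fun x => ((x.1, x.2.2.1), (x.2.1, x.2.2.2))) ?_ ?_
    · rintro ⟨a, b, a', b'⟩ hx
      simp only [coe_filter, mem_product, Set.mem_ofPred_eq] at hx ⊢
      obtain ⟨⟨ha, hb, ha', hb'⟩, hx⟩ := hx
      refine ⟨⟨⟨ha, ha'⟩, hb, hb'⟩, ?_⟩
      rw [div_eq_div_iff (hA0 _ ha') (hB0 _ hb)]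
      linear_combination hx
    · rintro ⟨a, b, a', b'⟩ - ⟨c, d, c', d'⟩ - hx
      simp only [Prod.mk.injEq] at hx ⊢
      tauto
  have h2 : #{q ∈ (A ×ˢ A) ×ˢ (A ×ˢ A) | q.1.1 / q.1.2 = q.2.1 / q.2.2} ≤ mulE A := by
    refine card_le_card_of_injOn (fun q => (q.1.1, q.2.2, q.2.1, q.1.2)) ?_ ?_
    · rintro ⟨⟨a, b⟩, c, d⟩ hx
      simp only [coe_filter, mem_product, Set.mem_ofPred_eq] at hx ⊢
      obtain ⟨⟨⟨ha, hb⟩, hc, hd⟩, hx⟩ := hx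
      rw [div_eq_div_iff (hA0 _ hb) (hA0 _ hd)] at hx
      exact ⟨⟨ha, hd, hc, hb⟩, hx⟩
    · rintro ⟨⟨a, b⟩, c, d⟩ - ⟨⟨a', b'⟩, c', d'⟩ - hx
      simp only [Prod.mk.injEq] at hx ⊢
      tauto
  have h3 : #{q ∈ (B ×ˢ B) ×ˢ (B ×ˢ B) | q.1.2 / q.1.1 = q.2.2 / q.2.1} ≤ mulE B := by
    refine card_le_card_of_injOn (fun q => (q.1.2, q.2.1, q.2.2, q.1.1)) ?_ ?_
    · rintro ⟨⟨a, b⟩, c, d⟩ hx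
      simp only [coe_filter, mem_product, Set.mem_ofPred_eq] at hx ⊢
      obtain ⟨⟨⟨ha, hb⟩, hc, hd⟩, hx⟩ := hx
      rw [div_eq_div_iff (hB0 _ ha) (hB0 _ hc)] at hx
      exact ⟨⟨hb, hc, hd, ha⟩, hx⟩
    · rintro ⟨⟨a, b⟩, c, d⟩ - ⟨⟨a', b'⟩, c', d'⟩ - hx
      simp only [Prod.mk.injEq] at hx ⊢
      tauto
  calc mulQuad A B A B ^ 2 ≤ _ := Nat.pow_le_pow_left h1 2
    _ ≤ _ := h
    _ ≤ _ := Nat.mul_le_mul h2 h3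

theorem mulQuad_le {l : ℝ} (hl : 0 ≤ l) {A₁ A₂ A₃ A₄ : Finset (ZMod p)}
    (h₁ : 0 ∉ A₁ ∧ (mulE A₁ : ℝ) ≤ l * #A₁ ^ 4) (h₂ : 0 ∉ A₂ ∧ (mulE A₂ : ℝ) ≤ l * #A₂ ^ 4)
    (h₃ : 0 ∉ A₃ ∧ (mulE A₃ : ℝ) ≤ l * #A₃ ^ 4) (h₄ : 0 ∉ A₄ ∧ (mulE A₄ : ℝ) ≤ l * #A₄ ^ 4) :
    (mulQuad A₁ A₂ A₃ A₄ : ℝ) ≤ l * (#A₁ * #A₂ * #A₃ * #A₄) := by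
  have key : ∀ A B : Finset (ZMod p), (0 ∉ A ∧ (mulE A : ℝ) ≤ l * #A ^ 4) →
      (0 ∉ B ∧ (mulE B : ℝ) ≤ l * #B ^ 4) → (mulQuad A B A B : ℝ) ≤ l * (#A * #B) ^ 2 := by
    intro A B hA hB
    refine le_of_sq_le_sq ?_ (by positivity)
    have h : (mulQuad A B A B : ℝ) ^ 2 ≤ mulE A * mulE B := by
      exact_mod_cast sq_mulQuad_self_le hA.1 hB.1
    calc _ ≤ _ := h
      _ ≤ (l * #A ^ 4) * (l * #B ^ 4) := by gcongr; exacts [hA.2, hB.2]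
      _ = _ := by ring
  refine le_of_sq_le_sq ?_ (by positivity)
  have h : (mulQuad A₁ A₂ A₃ A₄ : ℝ) ^ 2 ≤ mulQuad A₁ A₂ A₁ A₂ * mulQuad A₃ A₄ A₃ A₄ := by
    exact_mod_cast sq_mulQuad_le A₁ A₂ A₃ A₄
  calc _ ≤ _ := h
    _ ≤ (l * (#A₁ * #A₂) ^ 2) * (l * (#A₃ * #A₄) ^ 2) := by
      gcongr
      exacts [key _ _ h₁ h₂, key _ _ h₃ h₄]
    _ = _ := by ring

theorem mulQuad_eq_sum (A₁ A₂ A₃ A₄ : Finset (ZMod p)) : mulQuad A₁ A₂ A₃ A₄ =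
    ∑ a ∈ A₁, ∑ b ∈ A₂, ∑ c ∈ A₃, ∑ d ∈ A₄, if a * b = c * d then 1 else 0 := by
  rw [mulQuad, card_filter]
  simp only [sum_product]

/-- The bound `E×(S) ≤ l |S|⁴` is stable under disjoint unions. -/
theorem mulE_union_le {l : ℝ} (hl : 0 ≤ l) {U V : Finset (ZMod p)} (hUV : Disjoint U V)
    (hU : 0 ∉ U ∧ (mulE U : ℝ) ≤ l * #U ^ 4) (hV : 0 ∉ V ∧ (mulE V : ℝ) ≤ l * #V ^ 4) :
    (mulE (U ∪ V) : ℝ) ≤ l * #(U ∪ V) ^ 4 := by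
  have h : ∀ W : Bool → Finset (ZMod p), Disjoint (W true) (W false) →
    (∀ i, 0 ∉ W i ∧ (mulE (W i) : ℝ) ≤ l * #(W i) ^ 4) →
    (mulE (W true ∪ W false) : ℝ) ≤ l * #(W true ∪ W false) ^ 4 := by
    intro W hd hW
    have hsplit : mulE (W true ∪ W false) =
        ∑ i, ∑ j, ∑ k, ∑ m, mulQuad (W i) (W j) (W k) (W m) := by
      change mulQuad _ _ _ _ = _
      simp only [mulQuad_eq_sum, sum_union hd, Fintype.sum_bool, sum_add_distrib]
      ring
    rw [hsplit]
    push_cast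
    calc _ ≤ ∑ i, ∑ j, ∑ k, ∑ m, l * ((#(W i) : ℝ) * #(W j) * #(W k) * #(W m)) := by
          gcongr
          exact mulQuad_le hl (hW _) (hW _) (hW _) (hW _)
      _ = _ := by
        rw [card_union_of_disjoint hd]
        simp only [Fintype.sum_bool]
        push_cast
        ring
  exact h (fun i => bif i then U else V) hUV (by rintro (_ | _) <;> assumption)

theorem mulE_le_sum_card_inter {D : Finset (ZMod p)} (hD : 0 ∉ D) :
    mulE D ≤ ∑ b ∈ D, ∑ a ∈ D, #(a • D ∩ b • D) := by
  have hD0 : ∀ a ∈ D, a ≠ 0 := fun a ha h => hD (h ▸ ha)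
  have h : mulE D = ∑ b ∈ D, ∑ a ∈ D, #{q ∈ D ×ˢ D | a * q.1 = b * q.2} := by
    change mulQuad D D D D = _
    simp only [mulQuad_eq_sum, card_filter, sum_product]
    refine Eq.symm (sum_comm.trans ?_)
    exact sum_congr rfl fun a _ => sum_comm
  rw [h]
  refine sum_le_sum fun b hb => sum_le_sum fun a ha => ?_
  refine card_le_card_of_injOn (fun q => a * q.1) ?_ ?_
  · rintro ⟨x, y⟩ hq
    simp only [coe_filter, mem_product, Set.mem_ofPred_eq] at hq
    rw [mem_coe, mem_inter]
    refine ⟨smul_mem_smul_finset hq.1.1, ?_⟩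
    simp only [hq.2]
    exact smul_mem_smul_finset hq.1.2
  · rintro ⟨x, y⟩ hq ⟨x', y'⟩ hq' h
    simp only [coe_filter, mem_product, Set.mem_ofPred_eq] at hq hq' h
    have hx := mul_left_cancel₀ (hD0 a ha) h
    subst hx
    have := mul_left_cancel₀ (hD0 b hb) (hq.2.symm.trans hq'.2)
    simp [this]

theorem exists_pivot {D : Finset (ZMod p)} (hD : 0 ∉ D) {R : ℝ} (hR : 0 < R)
    (hE : (#D : ℝ) ^ 4 / R < mulE D) :
    ∃ e ∈ D, ∃ A ⊆ D, (#D : ℝ) ^ 2 / (2 * R) < #A ∧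
      ∀ a ∈ A, (#D : ℝ) ^ 2 / (2 * R) ≤ #(a • D ∩ e • D) := by
  have h1 : ∑ b ∈ D, (#D : ℝ) ^ 3 / R < ∑ b ∈ D, ∑ a ∈ D, (#(a • D ∩ b • D) : ℝ) := by
    calc ∑ b ∈ D, (#D : ℝ) ^ 3 / R = (#D : ℝ) ^ 4 / R := by
          rw [sum_const, nsmul_eq_mul]; ring
      _ < mulE D := hE
      _ ≤ _ := by exact_mod_cast mulE_le_sum_card_inter hD
  obtain ⟨e, he, h2⟩ := exists_lt_of_sum_lt h1
  set w : ℝ := (#D : ℝ) ^ 2 / (2 * R) with hw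
  have hw0 : 0 ≤ w := by positivity
  have hd : (0 : ℝ) < #D := by exact_mod_cast card_pos.2 ⟨e, he⟩
  refine ⟨e, he, {a ∈ D | w ≤ #(a • D ∩ e • D)}, filter_subset _ _, ?_,
    fun a ha => (mem_filter.1 ha).2⟩
  have h3 : ∑ a ∈ D, (#(a • D ∩ e • D) : ℝ) ≤
      ∑ a ∈ D, ((#D : ℝ) * (if w ≤ #(a • D ∩ e • D) then 1 else 0) + w) := by
    refine sum_le_sum fun a _ => ?_
    have : (#(a • D ∩ e • D) : ℝ) ≤ #D := by
      exact_mod_cast (card_le_card inter_subset_left).trans card_image_le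
    split_ifs with h <;> linarith
  rw [sum_add_distrib, ← mul_sum, sum_boole, sum_const, nsmul_eq_mul] at h3
  have h4 : (#D : ℝ) ^ 3 / R = #D * (w + w) := by rw [hw]; field_simp; norm_num
  have h5 := h2.trans_le h3
  rw [h4, ← mul_add] at h5
  have := lt_of_mul_lt_mul_left h5 hd.le
  linarith
end Mul

section Extraction
open scoped Pointwise

theorem addE_le_sum_sq {p : ℕ} [NeZero p] (C : Finset (ZMod p)) :
    (addE C : ℝ) ≤ ∑ x, (#(shiftInter C x) : ℝ) ^ 2 := by
  have h : addE C = ∑ a ∈ C, ∑ c ∈ C, #(shiftInter C (a - c)) := by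
    rw [addE, card_filter]
    simp only [sum_product]
    refine sum_congr rfl fun a _ => ?_
    rw [sum_comm]
    refine sum_congr rfl fun c _ => ?_
    rw [sum_comm, shiftInter, card_filter]
    refine sum_congr rfl fun d _ => ?_
    have : ∀ b, a + b = c + d ↔ d - (a - c) = b := fun b =>
      ⟨fun h => by linear_combination -h, fun h => by linear_combination -h⟩
    simp only [this, sum_ite_eq]
  rw [h]
  simp only [sq]
  rw [sum_card_shiftInter_mul C fun x => (#(shiftInter C x) : ℝ)]
  push_cast
  rfl

theorem le_of_pivot_bounds {p N M d n s : ℝ} (hp : 0 < p) (hN : 0 < N) (hM : 0 < M)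
    (hpN : p ≤ N ^ 2) (hd : N / (16 * M) ≤ d) (hdN : d ≤ N) (hs : s * d ≤ 512 * N ^ 2 * M ^ 2)
    (hs0 : 0 ≤ s) (hn : d ^ 2 / (2 * (N * M)) ≤ n) (hnd : n ≤ d)
    (h : p * n ^ 2 * (d ^ 2 / (2 * (N * M))) ^ 4 * d ^ 7 ≤ s ^ 12 * (p + n ^ 2)) :
    p ≤ 128 * 512 ^ 12 * 16 ^ 31 * N * M ^ 61 := by
  have hd0 : 0 < d := lt_of_lt_of_le (by positivity) hd
  set w := d ^ 2 / (2 * (N * M)) with hw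
  have hw0 : 0 < w := by positivity
  have hn0 : 0 < n := hw0.trans_le hn
  set q := (w / N) ^ 2 with hq
  have hq0 : 0 < q := by positivity
  have hq1 : q ≤ 1 := by
    apply pow_le_one₀ (by positivity)
    rw [div_le_one hN]
    linarith
  have hqp : q * p ≤ n ^ 2 := by
    calc q * p ≤ q * N ^ 2 := by gcongr
      _ = w ^ 2 := by rw [hq]; field_simp
      _ ≤ n ^ 2 := by gcongr
  have h1 : q * (p + n ^ 2) ≤ 2 * n ^ 2 := by nlinarith [sq_nonneg n]
  have h2 : p * q * w ^ 4 * d ^ 7 ≤ 2 * s ^ 12 := by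
    have h3 : (p * q * w ^ 4 * d ^ 7) * (p + n ^ 2) ≤ 2 * s ^ 12 * (p + n ^ 2) := by
      calc _ = (q * (p + n ^ 2)) * (p * w ^ 4 * d ^ 7) := by ring
        _ ≤ (2 * n ^ 2) * (p * w ^ 4 * d ^ 7) := by gcongr
        _ = 2 * (p * n ^ 2 * w ^ 4 * d ^ 7) := by ring
        _ ≤ 2 * (s ^ 12 * (p + n ^ 2)) := by gcongr
        _ = _ := by ring
    exact le_of_mul_le_mul_right h3 (by positivity)
  have h4 : p * d ^ 31 ≤ 128 * 512 ^ 12 * N ^ 32 * M ^ 30 := by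
    calc p * d ^ 31 = (p * q * w ^ 4 * d ^ 7) * d ^ 12 * (64 * N ^ 8 * M ^ 6) := by
          rw [hq, hw]; field_simp; norm_num
      _ ≤ (2 * s ^ 12) * d ^ 12 * (64 * N ^ 8 * M ^ 6) := by gcongr
      _ = 2 * (s * d) ^ 12 * (64 * N ^ 8 * M ^ 6) := by ring
      _ ≤ 2 * (512 * N ^ 2 * M ^ 2) ^ 12 * (64 * N ^ 8 * M ^ 6) := by gcongr
      _ = _ := by ring
  have h5 : p * (N / (16 * M)) ^ 31 ≤ 128 * 512 ^ 12 * N ^ 32 * M ^ 30 := by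
    refine le_trans ?_ h4
    gcongr
  calc p = p * (N / (16 * M)) ^ 31 * ((16 * M) / N) ^ 31 := by
        rw [mul_assoc, ← mul_pow]; field_simp
    _ ≤ (128 * 512 ^ 12 * N ^ 32 * M ^ 30) * ((16 * M) / N) ^ 31 := by gcongr
    _ = _ := by rw [div_pow, mul_pow]; field_simp

/-- A set with large additive energy has a nonempty subset with small multiplicative energy. -/
theorem exists_subset_mulE_le {p : ℕ} [Fact p.Prime] (C : Finset (ZMod p)) {N M : ℝ}
    (hN : 0 < N) (hM : 0 < M) (hpN : p ≤ N ^ 2) (hC : (#C : ℝ) ≤ N) (h₁ : 16 * M ≤ N)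
    (h₂ : 512 * M ^ 3 ≤ N) (h₃ : 128 * 512 ^ 12 * 16 ^ 31 * N * M ^ 61 < p)
    (hE : N ^ 3 / M < addE C) :
    ∃ D ⊆ C, D.Nonempty ∧ 0 ∉ D ∧ (mulE D : ℝ) ≤ #D ^ 4 / (N * M) := by
  obtain ⟨D₁, hD₁C, hD₁, hDD⟩ :=
    exists_subset_card_sub_le C hM hN hC (hE.trans_le (addE_le_sum_sq C))
  set D := D₁.erase 0 with hD
  have hDC : D ⊆ C := (erase_subset _ _).trans hD₁C
  have hu : 1 ≤ N / (16 * M) := by rwa [one_le_div (by positivity)]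
  have hd : N / (16 * M) ≤ #D := by
    have h1 : (#D₁ : ℝ) ≤ #D + 1 := by
      have := pred_card_le_card_erase (s := D₁) (a := 0)
      rw [← hD] at this
      exact_mod_cast (by omega : #D₁ ≤ #D + 1)
    have h2 : N / (8 * M) = N / (16 * M) + N / (16 * M) := by field_simp; norm_num
    linarith
  have hd0 : (0 : ℝ) < #D := by linarith
  have hDne : D.Nonempty := card_pos.1 (by exact_mod_cast hd0)
  have hD0 : 0 ∉ D := notMem_erase 0 D₁
  refine ⟨D, hDC, hDne, hD0, ?_⟩
  by_contra! hcon
  obtain ⟨e, -, A, hAD, hA, hW⟩ := exists_pivot hD0 (by positivity) hcon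
  set w := (#D : ℝ) ^ 2 / (2 * (N * M)) with hw
  have hw1 : 1 ≤ w := by
    calc (1 : ℝ) ≤ N / (512 * M ^ 3) := by rwa [one_le_div (by positivity)]
      _ = (N / (16 * M)) ^ 2 / (2 * (N * M)) := by field_simp; norm_num
      _ ≤ w := by rw [hw]; gcongr
  have hA1 : 1 < #A := by exact_mod_cast hw1.trans_lt hA
  obtain ⟨a, ha, b, hb, c, hc, d, hd', -, hX⟩ := exists_ratio_card_sum A hA1
  have hXD := card_dilates_sum_mul_le hDne a b c d e
  have hmono : #(a • A - b • A + (c • A + c • A) - (d • A + d • A)) ≤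
      #(a • D - b • D + (c • D + c • D) - (d • D + d • D)) := by gcongr
  have hs : (#(D - D) : ℝ) * #D ≤ 512 * N ^ 2 * M ^ 2 := by
    refine le_trans ?_ hDD
    have : D ⊆ D₁ := erase_subset _ _
    gcongr
  refine absurd (le_of_pivot_bounds (p := p) (d := #D) (n := #A) (s := #(D - D))
    (by exact_mod_cast (Fact.out : p.Prime).pos) hN hM hpN hd ?_ hs (by positivity) hA.le ?_ ?_)
    h₃.not_ge
  · exact le_trans (by exact_mod_cast card_le_card hDC) hC
  · exact_mod_cast card_le_card hAD
  generalize #(a • D - b • D + (c • D + c • D) - (d • D + d • D)) = X at hXD hmono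
  have hX' : (p : ℝ) * #A ^ 2 ≤ X * (p + #A ^ 2) := by
    exact_mod_cast hX.trans (Nat.mul_le_mul_right _ hmono)
  have hXD' : (X : ℝ) * (#(a • D ∩ e • D) * #(b • D ∩ e • D) * #(c • D ∩ e • D) *
      #(d • D ∩ e • D)) * #D ^ 7 ≤ #(D - D) ^ 12 := by exact_mod_cast hXD
  have hw0 : 0 ≤ w := by linarith
  calc (p : ℝ) * #A ^ 2 * w ^ 4 * #D ^ 7 ≤ X * (p + #A ^ 2) * w ^ 4 * #D ^ 7 := by gcongr
    _ = X * (w * w * w * w) * #D ^ 7 * (p + #A ^ 2) := by ring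
    _ ≤ X * (#(a • D ∩ e • D) * #(b • D ∩ e • D) * #(c • D ∩ e • D) *
      #(d • D ∩ e • D)) * #D ^ 7 * (p + #A ^ 2) := by
        gcongr
        exacts [hW a ha, hW b hb, hW c hc, hW d hd']
    _ ≤ _ := by gcongr

theorem exists_decomposition {p : ℕ} [Fact p.Prime] (A : Finset (ZMod p)) {M : ℝ}
    (hA : 0 < #A) (hM : 0 < M) (hpN : (p : ℝ) ≤ #A ^ 2) (h₁ : 16 * M ≤ #A)
    (h₂ : 512 * M ^ 3 ≤ #A) (h₃ : 128 * 512 ^ 12 * 16 ^ 31 * #A * M ^ 61 < p) :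
    ∃ B C : Finset (ZMod p), Disjoint B C ∧ B ∪ C = A ∧
      (addE B : ℝ) ≤ #A ^ 3 / M ∧ (mulE C : ℝ) ≤ #A ^ 3 / M := by
  have hN : (0 : ℝ) < #A := by exact_mod_cast hA
  set l : ℝ := 1 / (#A * M) with hl
  have hl0 : 0 ≤ l := by positivity
  obtain ⟨C, hC, hmax⟩ := exists_max_image
    {C ∈ A.powerset | 0 ∉ C ∧ (mulE C : ℝ) ≤ l * #C ^ 4} card
    ⟨∅, mem_filter.2 ⟨empty_mem_powerset A, notMem_empty 0, by simp [mulE]⟩⟩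
  simp only [mem_filter, mem_powerset] at hC hmax
  obtain ⟨hCA, hC⟩ := hC
  refine ⟨A \ C, C, sdiff_disjoint, sdiff_union_of_subset hCA, ?_, ?_⟩
  · by_contra! hcon
    obtain ⟨D, hDA, hDne, hD0, hD⟩ := exists_subset_mulE_le (A \ C) hN hM hpN
      (by exact_mod_cast card_le_card sdiff_subset) h₁ h₂ h₃ hcon
    have hdisj : Disjoint C D := (disjoint_sdiff.mono_right hDA)
    have hD' : (mulE D : ℝ) ≤ l * #D ^ 4 := by rw [hl, one_div_mul_eq_div]; exact hD
    have := hmax (C ∪ D) ⟨union_subset hCA (hDA.trans sdiff_subset), by simp [hC.1, hD0],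
      mulE_union_le hl0 hdisj hC ⟨hD0, hD'⟩⟩
    rw [card_union_of_disjoint hdisj] at this
    have := hDne.card_pos
    omega
  · have : (#C : ℝ) ≤ #A := by exact_mod_cast card_le_card hCA
    calc (mulE C : ℝ) ≤ l * #C ^ 4 := hC.2
      _ ≤ l * #A ^ 4 := by gcongr
      _ = _ := by rw [hl]; field_simp

end Extraction

/-- Theorem 4.2, second part: low-energy decompositions in `𝔽_p` for `|A| ≥ √p`,
with `δ = 4/283` and `θ = 223/249`. -/
theorem low_energy_decomposition_Fp_sqrt_large :
    ∃ K : ℝ, 0 < K ∧ ∃ p₀ : ℕ, ∀ p : ℕ, p.Prime → p₀ ≤ p →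
      ∀ A : Finset (ZMod p), Real.sqrt p ≤ (A.card : ℝ) →
        ∃ B C : Finset (ZMod p), Disjoint B C ∧ B ∪ C = A ∧
          (max (addE B) (mulE C) : ℝ) ≤
            K * (A.card : ℝ) ^ 3 * ((A.card : ℝ) / p) ^ ((4 : ℝ) / 283) *
              Real.log A.card ^ ((223 : ℝ) / 249) := by
  refine ⟨16, by norm_num, 9, fun p hp hp9 A hA => ?_⟩
  have := Fact.mk hp
  have hp0 : (0 : ℝ) < p := by exact_mod_cast hp.pos
  have hN3 : (3 : ℝ) ≤ #A := by
    refine le_trans ?_ hA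
    rw [Real.le_sqrt (by norm_num) hp0.le]
    norm_num
    exact_mod_cast hp9
  have hN : (0 : ℝ) < #A := by linarith
  have hpN : (p : ℝ) ≤ #A ^ 2 := (Real.sqrt_le_left hN.le).1 hA
  have hNp : (#A : ℝ) ≤ p := by
    have := card_le_univ A
    rw [ZMod.card] at this
    exact_mod_cast this
  set y : ℝ := p / #A with hy
  have hy1 : 1 ≤ y := by rwa [one_le_div hN]
  have hy0 : 0 < y := by linarith
  have hyN : y ≤ #A := by rw [hy, div_le_iff₀ hN]; linarith
  set δ : ℝ := 4 / 283 with hδ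
  have hpow : ∀ k : ℕ, k ≤ 61 → (y ^ δ) ^ k ≤ y := by
    intro k hk
    rw [← Real.rpow_natCast, ← Real.rpow_mul hy0.le]
    calc y ^ (δ * k) ≤ y ^ (1 : ℝ) := by
          apply Real.rpow_le_rpow_of_exponent_le hy1
          have : (k : ℝ) ≤ 61 := by exact_mod_cast hk
          rw [hδ]; linarith
      _ = y := Real.rpow_one y
  have hyδ : 0 < y ^ δ := Real.rpow_pos_of_pos hy0 _
  obtain ⟨B, C, hdisj, hunion, hB, hC⟩ := exists_decomposition A (M := y ^ δ / 16)
    (by exact_mod_cast hN) (by positivity) hpN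
    (by have := hpow 1 (by norm_num); rw [pow_one] at this; linarith)
    (by have := hpow 3 (by norm_num); rw [div_pow]; linarith)
    (by
      have h := hpow 61 le_rfl
      have hp' : (p : ℝ) = #A * y := by rw [hy]; field_simp
      have h' : (#A : ℝ) * (y ^ δ) ^ 61 ≤ p :=
        (mul_le_mul_of_nonneg_left h hN.le).trans_eq hp'.symm
      rw [div_pow]
      calc (128 * 512 ^ 12 * 16 ^ 31 * #A * ((y ^ δ) ^ 61 / 16 ^ 61) : ℝ) =
            (128 * 512 ^ 12 * 16 ^ 31 / 16 ^ 61) * (#A * (y ^ δ) ^ 61) := by ring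
        _ ≤ (128 * 512 ^ 12 * 16 ^ 31 / 16 ^ 61) * p := by gcongr
        _ < 1 * p := by gcongr; norm_num
        _ = p := one_mul _)
  refine ⟨B, C, hdisj, hunion, (max_le hB hC).trans ?_⟩
  have hlog : 1 ≤ Real.log #A := by
    rw [Real.le_log_iff_exp_le hN]
    linarith [Real.exp_one_lt_d9]
  have hlog' : 1 ≤ Real.log #A ^ ((223 : ℝ) / 249) := Real.one_le_rpow hlog (by norm_num)
  have hinv : ((#A : ℝ) / p) ^ δ = (y ^ δ)⁻¹ := by
    rw [← Real.inv_rpow hy0.le, hy, inv_div]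
  rw [hinv]
  have hK : (#A : ℝ) ^ 3 / (y ^ δ / 16) = 16 * #A ^ 3 * (y ^ δ)⁻¹ := by
    generalize y ^ δ = Y
    rw [div_div_eq_mul_div, div_eq_mul_inv]
    ring
  rw [hK]
  exact le_mul_of_one_le_right (by positivity) hlog'
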